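/- Theorem (constant gcd of minors implies properness). Given an implicitization-matrix datum for φ, if the gcd of Δ_{α₁}, …, Δ_{α_d} in K[X₁,X₂,X₃,X₄] is a nonzero constant of K, then φ is proper, i.e. K(φ₁,φ₂,φ₃) = K(u,v). -/

import Mathlib

open MvPolynomial

/-- The rational function field `K(u,v)`, realized as the fraction field of `K[u,v]`. -/
noncomputable abbrev RatFuncTwo (K : Type*) [Field K] : Type _ :=
  FractionRing (MvPolynomial (Fin 2) K)

/-- The three affine coordinates `φᵢ = pᵢ(u,v,1)/p₄(u,v,1)` (for `i = 1,2,3`) of the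
parameterization `φ` determined by `p = (p₁,p₂,p₃,p₄)`, as elements of `K(u,v)`. -/
noncomputable def phiCoord {K : Type*} [Field K]
    (p : Fin 4 → MvPolynomial (Fin 3) K) (i : Fin 3) : RatFuncTwo K :=
  algebraMap (MvPolynomial (Fin 2) K) (RatFuncTwo K)
      (MvPolynomial.aeval ![MvPolynomial.X 0, MvPolynomial.X 1, 1] (p i.castSucc)) /
    algebraMap (MvPolynomial (Fin 2) K) (RatFuncTwo K)
      (MvPolynomial.aeval ![MvPolynomial.X 0, MvPolynomial.X 1, 1] (p 3))

/-- `φ` is proper (birational onto its image) if the subfield `K(φ₁,φ₂,φ₃)` of `K(u,v)`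
generated over `K` by `φ₁, φ₂, φ₃` is all of `K(u,v)`. -/
noncomputable def IsProperParam {K : Type*} [Field K]
    (p : Fin 4 → MvPolynomial (Fin 3) K) : Prop :=
  IntermediateField.adjoin K {phiCoord p 0, phiCoord p 1, phiCoord p 2} = ⊤

theorem MvPolynomial.aeval_const_mul_of_isHomogeneous {σ K A : Type*} [CommRing K] [CommRing A]
    [Algebra K A] {q : MvPolynomial σ K} {k : ℕ} (hq : q.IsHomogeneous k) (c : A) (x : σ → A) :
    aeval (fun i => c * x i) q = c ^ k * aeval x q := by
  simp only [aeval_def, eval₂_eq, Finset.mul_sum]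
  refine Finset.sum_congr rfl fun d hd => ?_
  have hdeg : ∑ i ∈ d.support, d i = k := by
    have := hq (mem_support_iff.mp hd)
    simpa [Finsupp.weight_apply, Finsupp.sum] using this
  simp only [mul_pow, Finset.prod_mul_distrib, Finset.prod_pow_eq_pow_sum, hdeg]
  ring

theorem Subalgebra.mvPolynomial_aeval_mem {σ K A : Type*} [CommRing K] [CommRing A] [Algebra K A]
    (S : Subalgebra K A) {x : σ → A} (hx : ∀ i, x i ∈ S) (q : MvPolynomial σ K) :
    aeval x q ∈ S := by
  induction q using MvPolynomial.induction_on with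
  | C a => simp
  | add p q hp hq => simpa using add_mem hp hq
  | mul_X p i hp => simpa using mul_mem hp (hx i)

/-- Dehomogenization with respect to the last variable is injective on forms. -/
theorem MvPolynomial.aeval_dehomogenize_ne_zero {K : Type*} [Field K]
    {q : MvPolynomial (Fin 3) K} {k : ℕ} (hq : q.IsHomogeneous k) (hq0 : q ≠ 0) :
    aeval ![(X 0 : MvPolynomial (Fin 2) K), X 1, 1] q ≠ 0 := by
  intro h
  let L := FractionRing (MvPolynomial (Fin 3) K)
  let t : Fin 3 → L := fun i => algebraMap (MvPolynomial (Fin 3) K) L (X i)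
  have ht : t 2 ≠ 0 :=
    (map_ne_zero_iff _ (IsFractionRing.injective (MvPolynomial (Fin 3) K) L)).mpr (X_ne_zero 2)
  have h₁ : aeval ![t 0 / t 2, t 1 / t 2, 1] q = 0 := by
    have h₂ := congrArg (aeval ![t 0 / t 2, t 1 / t 2]) h
    rw [map_zero, ← AlgHom.comp_apply, comp_aeval] at h₂
    rw [← h₂]
    congr 2
    ext i
    fin_cases i <;> simp
  have h₃ : aeval t q = 0 := by
    have h₄ := aeval_const_mul_of_isHomogeneous hq (t 2) ![t 0 / t 2, t 1 / t 2, 1]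
    rw [h₁, mul_zero] at h₄
    rw [← h₄]
    congr 2
    ext i
    fin_cases i <;> simp [mul_div_cancel₀ _ ht]
  refine hq0 (IsFractionRing.injective (MvPolynomial (Fin 3) K) L ?_)
  rw [map_zero, ← h₃]
  have := aeval_algebraMap_apply (R := K) L (X : Fin 3 → MvPolynomial (Fin 3) K) q
  rw [aeval_X_left_apply] at this
  exact this.symm

theorem Matrix.det_isHomogeneous_of_columns {ι σ R : Type*} [Fintype ι] [DecidableEq ι]
    [CommRing R] (A : Matrix ι ι (MvPolynomial σ R)) (e : ι → ℕ)
    (h : ∀ i j, (A i j).IsHomogeneous (e j)) : A.det.IsHomogeneous (∑ j, e j) := by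
  rw [Matrix.det_apply]
  refine IsHomogeneous.sum _ _ _ fun s _ => ?_
  have := IsHomogeneous.prod Finset.univ (fun i => A (s i) i) e fun i _ => h (s i) i
  rcases Int.units_eq_one_or (Equiv.Perm.sign s) with hs | hs
  · simpa [hs] using this
  · simpa [hs] using this.neg

open scoped Matrix in
/-- A vector annihilating the columns of a `(n + 1) × n` matrix is proportional to the vector of
signed maximal minors. -/
theorem Matrix.signed_minor_mul_comm_of_vecMul_eq_zero {R : Type*} [CommRing R] {n : ℕ}
    (A : Matrix (Fin (n + 1)) (Fin n) R) (w : Fin (n + 1) → R) (hw : w ᵥ* A = 0)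
    (i j : Fin (n + 1)) :
    (-1) ^ (i : ℕ) * (A.submatrix i.succAbove id).det * w j =
      (-1) ^ (j : ℕ) * (A.submatrix j.succAbove id).det * w i := by
  let B : Matrix (Fin (n + 1)) (Fin (n + 1)) R :=
    Matrix.of fun k => Fin.cons ((Pi.single i 1 : Fin (n + 1) → R) k) (A k)
  have hsub : ∀ k : Fin (n + 1),
      B.submatrix k.succAbove Fin.succ = A.submatrix k.succAbove id := by
    intro k
    ext
    simp [B]
  have hdet : B.det = (-1) ^ (i : ℕ) * (A.submatrix i.succAbove id).det := by
    rw [Matrix.det_succ_column_zero, Finset.sum_eq_single i]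
    · rw [hsub]
      simp [B]
    · intro k _ hk
      simp [B, hk]
    · simp
  have hadj : B.adjugate 0 j = (-1) ^ (j : ℕ) * (A.submatrix j.succAbove id).det := by
    rw [Matrix.adjugate_fin_succ_eq_det_submatrix]
    have : (Fin.succAbove (0 : Fin (n + 1))) = Fin.succ := by
      ext
      simp
    rw [this, hsub]
    simp
  have hwB : w ᵥ* B = Pi.single 0 (w i) := by
    ext k
    refine Fin.cases ?_ (fun l => ?_) k
    · simp [Matrix.vecMul, dotProduct, B, Pi.single_apply]
    · simpa [Matrix.vecMul, dotProduct, B] using congrFun hw l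
  have hfin : ((w ᵥ* B) ᵥ* B.adjugate) j = B.det * w j := by
    rw [Matrix.vecMul_vecMul, Matrix.mul_adjugate, Matrix.vecMul_smul, Matrix.vecMul_one]
    simp
  rw [hwB, hdet] at hfin
  rw [← hfin, Matrix.single_vecMul, ← hadj]
  simp [mul_comm]

theorem IntermediateField.eq_top_of_X_mem {K : Type*} [Field K]
    (E : IntermediateField K (RatFuncTwo K))
    (h : ∀ i, algebraMap (MvPolynomial (Fin 2) K) (RatFuncTwo K) (X i) ∈ E) : E = ⊤ := by
  have hpoly : ∀ q, algebraMap (MvPolynomial (Fin 2) K) (RatFuncTwo K) q ∈ E := by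
    intro q
    have := E.toSubalgebra.mvPolynomial_aeval_mem h q
    have h₁ := aeval_algebraMap_apply (R := K) (RatFuncTwo K)
      (X : Fin 2 → MvPolynomial (Fin 2) K) q
    rw [aeval_X_left_apply] at h₁
    rw [← h₁]
    exact this
  refine eq_top_iff.mpr fun z _ => ?_
  obtain ⟨x, y, -, rfl⟩ := IsFractionRing.div_surjective (A := MvPolynomial (Fin 2) K) z
  exact div_mem (hpoly x) (hpoly y)

/-- A parameterization is proper as soon as the affine parameters are given by quotients of forms
of equal degree in the coordinates of the parameterization. -/
theorem isProperParam_of_forms {K : Type*} [Field K] (p : Fin 4 → MvPolynomial (Fin 3) K)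
    (N D : ℕ) (hphom : ∀ i, (p i).IsHomogeneous N) (hp4 : p 3 ≠ 0)
    (G : Fin 3 → MvPolynomial (Fin 4) K) (hG : ∀ i, (G i).IsHomogeneous D)
    (hG2 : aeval p (G 2) ≠ 0)
    (hGX : ∀ i : Fin 2,
      X i.castSucc * aeval p (G 2) = X 2 * aeval p (G i.castSucc)) :
    IsProperParam p := by
  let A := MvPolynomial (Fin 2) K
  let y : Fin 3 → A := ![X 0, X 1, 1]
  let ψ : A →ₐ[K] RatFuncTwo K := IsScalarTower.toAlgHom K A (RatFuncTwo K)
  have hψ : Function.Injective ψ := IsFractionRing.injective A (RatFuncTwo K)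
  let P : RatFuncTwo K := ψ (aeval y (p 3))
  have hP : P ≠ 0 :=
    (map_ne_zero_iff _ hψ).mpr (aeval_dehomogenize_ne_zero (hphom 3) hp4)
  let x : Fin 4 → RatFuncTwo K := ![phiCoord p 0, phiCoord p 1, phiCoord p 2, 1]
  have hx : ∀ i, ψ (aeval y (p i)) = P * x i := by
    have hx' : ∀ i : Fin 3, ψ (aeval y (p i.castSucc)) = P * phiCoord p i := fun i =>
      (mul_div_cancel₀ _ hP).symm
    intro i
    fin_cases i
    · exact hx' 0
    · exact hx' 1
    · exact hx' 2
    · exact (mul_one P).symm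
  have hGx : ∀ i, ψ (aeval y (aeval p (G i))) = P ^ D * aeval x (G i) := by
    intro i
    rw [← aeval_const_mul_of_isHomogeneous (hG i) P x, ← AlgHom.comp_apply, ← AlgHom.comp_apply,
      comp_aeval, AlgHom.coe_comp]
    congr 2
    ext j
    exact hx j
  have hG2' : ψ (aeval y (aeval p (G 2))) ≠ 0 :=
    (map_ne_zero_iff _ hψ).mpr
      (aeval_dehomogenize_ne_zero ((hG 2).aeval p hphom) hG2)
  rw [hGx] at hG2'
  have hmem : ∀ q : MvPolynomial (Fin 4) K, aeval x q ∈
      IntermediateField.adjoin K {phiCoord p 0, phiCoord p 1, phiCoord p 2} := by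
    intro q
    refine (IntermediateField.adjoin K
      {phiCoord p 0, phiCoord p 1, phiCoord p 2}).toSubalgebra.mvPolynomial_aeval_mem ?_ q
    intro i
    fin_cases i
    · exact IntermediateField.subset_adjoin _ _ (by simp [x])
    · exact IntermediateField.subset_adjoin _ _ (by simp [x])
    · exact IntermediateField.subset_adjoin _ _ (by simp [x])
    · exact one_mem (IntermediateField.adjoin K {phiCoord p 0, phiCoord p 1, phiCoord p 2})
  refine IntermediateField.eq_top_of_X_mem _ fun i => ?_
  have hi : ψ (X i) = aeval x (G i.castSucc) / aeval x (G 2) := by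
    have h := congrArg (fun q => ψ (aeval y q)) (hGX i)
    have hy : y i.castSucc = X i := by fin_cases i <;> rfl
    have hy2 : y 2 = 1 := rfl
    simp only [map_mul, aeval_X, hGx, hy, hy2, one_mul] at h
    rw [eq_div_iff (right_ne_zero_of_mul hG2')]
    refine mul_left_cancel₀ (pow_ne_zero D hP) ?_
    rw [← h]
    ring
  exact hi ▸ div_mem (hmem _) (hmem _)

/-- constant gcd of minors implies properness.  Given an
implicitization-matrix datum for `φ`, if the gcd of the signed maximal minors
`Δ_{α₁}, …, Δ_{α_d}` of `M*` is a nonzero constant of `K`, then `φ` is proper: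
`K(φ₁,φ₂,φ₃) = K(u,v)`. -/
theorem proper_of_gcd_of_minors_isUnit
    (K : Type*) [Field K] [CharZero K]
    (p : Fin 4 → MvPolynomial (Fin 3) K)
    (N : ℕ) (hN : 1 ≤ N) (hphom : ∀ i, (p i).IsHomogeneous N) (hp4 : p 3 ≠ 0)
    (F : MvPolynomial (Fin 4) K)
    (hFhom : ∃ D : ℕ, F.IsHomogeneous D) (hFirr : Irreducible F)
    (hFimp : ∀ G : MvPolynomial (Fin 4) K, aeval p G = 0 ↔ F ∣ G)
    (n : ℕ) (hn : 2 ≤ n) (m : ℕ) (hm : 1 ≤ m)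
    (α : Fin (n + 1) → (Fin 3 →₀ ℕ)) (hαinj : Function.Injective α)
    (hαdeg : ∀ i, (α i).sum (fun _ e => e) = m)
    (b : Fin 3 → Fin (n + 1))
    (hb1 : (X 0 : MvPolynomial (Fin 3) K) * monomial (α (b 2)) 1 =
      (X 2 : MvPolynomial (Fin 3) K) * monomial (α (b 0)) 1)
    (hb2 : (X 1 : MvPolynomial (Fin 3) K) * monomial (α (b 2)) 1 =
      (X 2 : MvPolynomial (Fin 3) K) * monomial (α (b 1)) 1)
    (M : Matrix (Fin (n + 1)) (Fin (n + 1)) (MvPolynomial (Fin 4) K))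
    (hcol0 : ∃ e : ℕ, 1 ≤ e ∧ ∀ i, (M i 0).IsHomogeneous e)
    (hcolhom : ∀ j : Fin n, ∃ dj : ℕ, 1 ≤ dj ∧ ∀ i, (M i j.succ).IsHomogeneous dj)
    (hcolmoving : ∀ j : Fin n,
      ∑ i : Fin (n + 1), (monomial (α i) (1 : K)) * (aeval p) (M i j.succ) = 0)
    (c : K) (hc : c ≠ 0) (δ : ℕ) (hδ : 1 ≤ δ)
    (hMdet : M.det = C c * F ^ δ)
    (Mstar : Matrix (Fin (n + 1)) (Fin n) (MvPolynomial (Fin 4) K))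
    (hMstar : ∀ i j, Mstar i j = M i j.succ)
    (Δ : Fin (n + 1) → MvPolynomial (Fin 4) K)
    (hΔ : ∀ i : Fin (n + 1),
      Δ i = (-1 : MvPolynomial (Fin 4) K) ^ (i : ℕ) *
        (Mstar.submatrix i.succAbove id).det)
    (hgcd : ∃ u : K, u ≠ 0 ∧ (∀ i, (C u : MvPolynomial (Fin 4) K) ∣ Δ i) ∧
      (∀ g : MvPolynomial (Fin 4) K, (∀ i, g ∣ Δ i) → g ∣ C u)) :
    IsProperParam p := by
  classical
  choose e _ he using hcolhom
  obtain ⟨u, hu, -, hgcd⟩ := hgcd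
  have hprop : ∀ i j, aeval p (Δ i) * monomial (α j) (1 : K) =
      aeval p (Δ j) * monomial (α i) (1 : K) := by
    intro i j
    have hw : Matrix.vecMul (fun k => monomial (α k) (1 : K)) (Mstar.map (aeval p)) = 0 := by
      ext1 k
      simpa [Matrix.vecMul, dotProduct, hMstar] using hcolmoving k
    have h := (Mstar.map (aeval p)).signed_minor_mul_comm_of_vecMul_eq_zero _ hw i j
    have hmap : ∀ k, aeval p (Δ k) =
        (-1) ^ (k : ℕ) * ((Mstar.map (aeval p)).submatrix k.succAbove id).det := by
      intro k
      rw [hΔ, map_mul, AlgHom.map_det]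
      simp [Matrix.submatrix_map]
    rw [hmap, hmap]
    exact h
  have hmon : ∀ i, monomial (α i) (1 : K) ≠ 0 := fun i => by simp
  have hne : aeval p (Δ (b 2)) ≠ 0 := by
    intro h0
    have hall : ∀ i, F ∣ Δ i := fun i => (hFimp _).mp <| by
      have h := hprop i (b 2)
      rw [h0, zero_mul] at h
      exact (mul_eq_zero.mp h).resolve_right (hmon _)
    exact hFirr.not_isUnit (isUnit_of_dvd_unit (hgcd F hall) ((isUnit_iff_ne_zero.mpr hu).map C))
  have hhom : ∀ i, (Δ i).IsHomogeneous (∑ j, e j) := by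
    intro i
    have h := (Mstar.submatrix i.succAbove id).det_isHomogeneous_of_columns e
      fun k j => by simpa [hMstar] using he j (i.succAbove k)
    rw [hΔ]
    rcases neg_one_pow_eq_or (MvPolynomial (Fin 4) K) (i : ℕ) with hs | hs
    · simpa [hs] using h
    · simpa [hs] using h.neg
  have hratio : ∀ (q : MvPolynomial (Fin 3) K) (i : Fin (n + 1)),
      q * monomial (α (b 2)) 1 = X 2 * monomial (α i) 1 →
      q * aeval p (Δ (b 2)) = X 2 * aeval p (Δ i) := by
    intro q i h
    refine mul_right_cancel₀ (hmon i) ?_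
    linear_combination (-q) * hprop i (b 2) + aeval p (Δ i) * h
  refine isProperParam_of_forms p N _ hphom hp4 (fun i => Δ (b i)) (fun i => hhom _) hne ?_
  intro i
  fin_cases i
  · exact hratio _ _ hb1
  · exact hratio _ _ hb2
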